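/- Let m be a positive odd integer, and for 0 ≤ k ≤ (m−1)/2 set F_m(k) = 2^{m−2k} · (m−k)(m−k−1)⋯(k+1) + (2m−2k−1)(2m−2k−3)⋯(2k+1), and let M = max_{0≤k≤(m−1)/2} F_m(k). Then for every prime p with p ≡ 1 (mod 4) and p > M, we have p ∤ D_p^(m). -/

import Mathlib

/-- The matrix `[(i² − j²)^m · ((i² − j²)/p)]_{1 ≤ i,j ≤ (p−1)/2}` over `ℤ`, where the
Legendre symbol is expressed via the Jacobi symbol (they agree for odd primes `p`). -/
def Dmat (p m : ℕ) : Matrix (Fin ((p - 1) / 2)) (Fin ((p - 1) / 2)) ℤ :=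
  Matrix.of (fun i j =>
    (((i : ℕ) + 1 : ℤ) ^ 2 - ((j : ℕ) + 1 : ℤ) ^ 2) ^ m *
      jacobiSym ((((i : ℕ) + 1 : ℤ) ^ 2 - ((j : ℕ) + 1 : ℤ) ^ 2)) p)

/-- `D_p^(m) = det[(i² − j²)^m · ((i² − j²)/p)]_{1 ≤ i,j ≤ (p−1)/2}`. -/
def Dp (p m : ℕ) : ℤ := (Dmat p m).det

/-- `E(m)` is the set of primes `p ≡ 1 (mod 4)` with `p ∣ D_p^(m)`. -/
def Eset (m : ℕ) : Set ℕ := {p : ℕ | p.Prime ∧ p % 4 = 1 ∧ (p : ℤ) ∣ Dp p m}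

/-- `F_m(k) = 2^(m−2k)·(m−k)(m−k−1)⋯(k+1) + (2m−2k−1)(2m−2k−3)⋯(2k+1)`. -/
def Fm (m k : ℕ) : ℕ :=
  2 ^ (m - 2 * k) * (∏ i ∈ Finset.Ioc k (m - k), i) +
    ∏ i ∈ Finset.range (m - 2 * k), (2 * k + 1 + 2 * i)

/-- If `z ^ n = 1` and `n` is even, the binomial expansion of `(z - 1) ^ (m + n)` folds modulo `n`. -/
theorem sub_one_pow_add_eq_sum {R : Type*} [CommRing R] {m n : ℕ} (hn : Even n) (hmn : m < n)
    {z : R} (hz : z ^ n = 1) :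
    (z - 1) ^ (m + n) = ∑ s ∈ Finset.range n,
      (-1) ^ (m + s) * (((m + n).choose s + (m + n).choose (s + n) : ℕ) : R) * z ^ s := by
  have hsign : (-1 : R) ^ n = 1 := hn.neg_one_pow
  have hexpand : (z - 1) ^ (m + n) = ∑ s ∈ Finset.range (m + n + 1),
      (-1) ^ (m + s) * ((m + n).choose s : R) * z ^ s := by
    rw [show z - 1 = -(-z + 1) by ring, neg_pow, add_pow, Finset.mul_sum]
    refine Finset.sum_congr rfl fun s _ => ?_
    rw [pow_add, hsign, neg_pow z, pow_add]
    ring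
  have hextend : ∑ s ∈ Finset.range (m + n + 1),
      (-1) ^ (m + s) * ((m + n).choose s : R) * z ^ s =
      ∑ s ∈ Finset.range (n + n), (-1) ^ (m + s) * ((m + n).choose s : R) * z ^ s := by
    refine Finset.sum_subset (Finset.range_subset_range.2 (by omega)) fun s _ hs => ?_
    rw [Nat.choose_eq_zero_of_lt (by simpa using hs)]
    simp
  rw [hexpand, hextend, Finset.sum_range_add, ← Finset.sum_add_distrib]
  refine Finset.sum_congr rfl fun s _ => ?_
  rw [add_comm n s, ← add_assoc m s n, pow_add _ (m + s) n, hsign, pow_add z s n, hz]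
  push_cast
  ring

/-- For distinct `n`-th roots of unity `x i`, the matrix `((x i - x j) ^ (m + n))` is nonsingular
as soon as its folded binomial coefficients do not vanish. -/
theorem det_sub_pow_ne_zero {K : Type*} [Field K] {m n : ℕ} (hn : Even n) (hmn : m < n)
    {x : Fin n → K} (hx : Function.Injective x) (hx1 : ∀ i, x i ^ n = 1)
    (hc : ∀ s < n, (((m + n).choose s + (m + n).choose (s + n) : ℕ) : K) ≠ 0) :
    (Matrix.of fun i j => (x i - x j) ^ (m + n)).det ≠ 0 := by
  have hx0 : ∀ i, x i ≠ 0 := by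
    intro i h
    have := hx1 i
    rw [h, zero_pow (by omega)] at this
    exact zero_ne_one this
  set c : Fin n → K := fun s =>
    (-1) ^ (m + (s : ℕ)) * (((m + n).choose s + (m + n).choose (s + n) : ℕ) : K) with hcdef
  have hfactor : (Matrix.of fun i j => (x i - x j) ^ (m + n)) =
      Matrix.vandermonde x * Matrix.diagonal c *
        (Matrix.vandermonde fun j => (x j)⁻¹).transpose *
        Matrix.diagonal fun j => x j ^ (m + n) := by
    ext i j
    have hz : (x i / x j) ^ n = 1 := by rw [div_pow, hx1, hx1, div_one]
    have hij : x i - x j = (x i / x j - 1) * x j := by field_simp [hx0 j]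
    rw [Matrix.mul_diagonal, Matrix.mul_apply, Matrix.of_apply, hij, mul_pow,
      sub_one_pow_add_eq_sum hn hmn hz, Finset.sum_range]
    congr 1
    refine Finset.sum_congr rfl fun s _ => ?_
    rw [Matrix.mul_diagonal, Matrix.vandermonde_apply, Matrix.transpose_apply,
      Matrix.vandermonde_apply, hcdef, div_eq_mul_inv, mul_pow]
    ring
  rw [hfactor]
  simp only [Matrix.det_mul, Matrix.det_transpose, Matrix.det_diagonal]
  refine mul_ne_zero (mul_ne_zero (mul_ne_zero ?_ ?_) ?_) ?_
  · exact Matrix.det_vandermonde_ne_zero_iff.2 hx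
  · exact Finset.prod_ne_zero_iff.2 fun s _ =>
      mul_ne_zero (pow_ne_zero _ (neg_ne_zero.2 one_ne_zero)) (hc s s.2)
  · exact Matrix.det_vandermonde_ne_zero_iff.2 fun i j h => hx (inv_injective h)
  · exact Finset.prod_ne_zero_iff.2 fun j _ => pow_ne_zero _ (hx0 j)

theorem prod_Ioc_eq_ascFactorial (k d : ℕ) :
    ∏ i ∈ Finset.Ioc k (k + d), i = (k + 1).ascFactorial d := by
  induction d with
  | zero => simp
  | succ d ih =>
    rw [← add_assoc, Finset.prod_Ioc_succ_top (by omega), ih, Nat.ascFactorial_succ]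
    ring

/-- With `p = 2n + 1`, the residue of `F_m(k)` is `2 ^ (m - 2k)` times a sum of two products of
consecutive integers. -/
theorem cast_Fm {n m k : ℕ} (hk : 2 * k ≤ m) :
    (Fm m k : ZMod (2 * n + 1)) = 2 ^ (m - 2 * k) *
      ((k + 1).ascFactorial (m - 2 * k) + (n + k + 1).ascFactorial (m - 2 * k) : ℕ) := by
  obtain ⟨d, rfl⟩ := Nat.exists_eq_add_of_le hk
  have h2n : (2 * n + 1 : ZMod (2 * n + 1)) = 0 := by
    exact_mod_cast ZMod.natCast_self (2 * n + 1)
  have hB : (∏ i ∈ Finset.range d, (2 * k + 1 + 2 * i) : ZMod (2 * n + 1)) =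
      2 ^ d * ((n + k + 1).ascFactorial d : ℕ) := by
    rw [Nat.ascFactorial_eq_prod_range, Nat.cast_prod, Finset.pow_eq_prod_const,
      ← Finset.prod_mul_distrib]
    refine Finset.prod_congr rfl fun i _ => ?_
    push_cast
    linear_combination -h2n
  rw [Fm, show 2 * k + d - k = k + d by omega, show 2 * k + d - 2 * k = d by omega,
    prod_Ioc_eq_ascFactorial]
  push_cast at hB ⊢
  rw [hB]
  ring

theorem cast_choose_ne_zero {p N k : ℕ} [hp : Fact p.Prime] (hN : N < p) (hk : k ≤ N) :
    (N.choose k : ZMod p) ≠ 0 := by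
  rw [Ne, ZMod.natCast_eq_zero_iff]
  intro h
  have : p ∣ N.factorial := by
    rw [← Nat.choose_mul_factorial_mul_factorial hk, mul_assoc]
    exact h.mul_right _
  exact absurd ((hp.out.dvd_factorial).1 this) (by omega)

theorem choose_mul_ascFactorial {n m k : ℕ} (hk : 2 * k ≤ m) :
    (m + n).choose k * (n + k + 1).ascFactorial (m - 2 * k) =
      (m + n).choose (m - k) * (k + 1).ascFactorial (m - 2 * k) := by
  obtain ⟨d, rfl⟩ := Nat.exists_eq_add_of_le hk
  have h1 := Nat.choose_mul_factorial_mul_factorial (n := 2 * k + d + n) (k := k) (by omega)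
  have h2 := Nat.choose_mul_factorial_mul_factorial (n := 2 * k + d + n) (k := k + d) (by omega)
  rw [show 2 * k + d + n - k = n + k + d by omega, ← Nat.factorial_mul_ascFactorial (n + k)] at h1
  rw [show 2 * k + d + n - (k + d) = n + k by omega, ← Nat.factorial_mul_ascFactorial k] at h2
  rw [show 2 * k + d - 2 * k = d by omega, show 2 * k + d - k = k + d by omega]
  refine Nat.eq_of_mul_eq_mul_left
    (Nat.mul_pos (Nat.factorial_pos k) (Nat.factorial_pos (n + k))) ?_
  linarith

theorem cast_choose_add_choose_ne_zero {n m k : ℕ} [Fact (2 * n + 1).Prime] (hmn : m < n)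
    (hk : 2 * k ≤ m) (hF : (Fm m k : ZMod (2 * n + 1)) ≠ 0) :
    (((m + n).choose k + (m + n).choose (m - k) : ℕ) : ZMod (2 * n + 1)) ≠ 0 := by
  intro h
  refine hF ?_
  have hC : ((m + n).choose k : ZMod (2 * n + 1)) ≠ 0 :=
    cast_choose_ne_zero (by omega) (by omega)
  have hmul := congrArg (Nat.cast (R := ZMod (2 * n + 1))) (choose_mul_ascFactorial (n := n) hk)
  rw [cast_Fm hk]
  refine mul_eq_zero_of_right _ ((mul_eq_zero.1 ?_).resolve_left hC)
  push_cast at h hmul ⊢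
  linear_combination hmul + ((k + 1).ascFactorial (m - 2 * k) : ZMod (2 * n + 1)) * h

theorem Fm_pos (m k : ℕ) : 0 < Fm m k :=
  Nat.add_pos_right _ (Finset.prod_pos fun _ _ => by omega)

theorem two_mul_add_one_le_Fm_zero {m : ℕ} (hm : 0 < m) : 2 * m + 1 ≤ Fm m 0 := by
  have hodd : 0 < ∏ i ∈ Finset.range m, (2 * 0 + 1 + 2 * i) :=
    Finset.prod_pos fun _ _ => by omega
  have hfac : m ≤ ∏ i ∈ Finset.Ioc 0 m, i :=
    Nat.le_of_dvd (Finset.prod_pos fun i hi => (Finset.mem_Ioc.1 hi).1)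
      (Finset.dvd_prod_of_mem _ (Finset.mem_Ioc.2 ⟨hm, le_rfl⟩))
  have htwo : 2 ≤ 2 ^ m := Nat.le_self_pow hm.ne' 2
  have := Nat.mul_le_mul htwo hfac
  simp only [Fm, Nat.mul_zero, Nat.sub_zero] at hodd ⊢
  omega

theorem cast_Dp {n m : ℕ} [Fact (2 * n + 1).Prime] :
    ((Dp (2 * n + 1) m : ℤ) : ZMod (2 * n + 1)) =
      (Matrix.of fun i j : Fin ((2 * n + 1 - 1) / 2) =>
        ((((i : ℕ) + 1 : ZMod (2 * n + 1)) ^ 2 - ((j : ℕ) + 1) ^ 2) ^ (m + n))).det := by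
  rw [Dp, Int.cast_det]
  congr 1
  ext i j
  simp only [Dmat, Matrix.map_apply, Matrix.of_apply]
  rw [← jacobiSym.legendreSym.to_jacobiSym, Int.cast_mul, legendreSym.eq_pow,
    show (2 * n + 1) / 2 = n by omega, pow_add]
  push_cast
  rfl

/-- Let `m` be a positive odd integer and
`M = max_{0 ≤ k ≤ (m−1)/2} F_m(k)`. Then every prime `p ≡ 1 (mod 4)` with `p > M`
satisfies `p ∤ D_p^(m)`. -/
theorem stmt12 (m : ℕ) (hm : Odd m) (hm0 : 0 < m)
    (p : ℕ) (hp : p.Prime) (h4 : p % 4 = 1)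
    (hpM : (Finset.range ((m - 1) / 2 + 1)).sup (Fm m) < p) :
    ¬ (p : ℤ) ∣ Dp p m := by
  obtain ⟨n, rfl⟩ : ∃ n, p = 2 * n + 1 := ⟨p / 2, by omega⟩
  have : Fact (2 * n + 1).Prime := ⟨hp⟩
  have hn : Even n := Nat.even_iff.2 (by omega)
  have hFlt : ∀ k, 2 * k ≤ m → Fm m k < 2 * n + 1 := fun k hk => by
    obtain ⟨r, rfl⟩ := hm
    exact (Finset.le_sup (f := Fm (2 * r + 1)) (Finset.mem_range.2 (by omega))).trans_lt hpM
  have hmn : m < n := by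
    have := two_mul_add_one_le_Fm_zero hm0
    have := hFlt 0 (by omega)
    omega
  have hF : ∀ k, 2 * k ≤ m → (Fm m k : ZMod (2 * n + 1)) ≠ 0 := fun k hk h =>
    absurd (Nat.le_of_dvd (Fm_pos m k) ((ZMod.natCast_eq_zero_iff _ _).1 h))
      (by have := hFlt k hk; omega)
  rw [← ZMod.intCast_zmod_eq_zero_iff_dvd, cast_Dp]
  have hhalf : (2 * n + 1 - 1) / 2 = n := by omega
  rw [hhalf]
  have hcast : ∀ a : ℕ, 0 < a → a < 2 * n + 1 → (a : ZMod (2 * n + 1)) ≠ 0 := fun a h0 h1 h =>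
    absurd (Nat.le_of_dvd h0 ((ZMod.natCast_eq_zero_iff _ _).1 h)) (by omega)
  refine det_sub_pow_ne_zero (x := fun i : Fin n => ((i : ℕ) + 1 : ZMod (2 * n + 1)) ^ 2)
    hn hmn ?_ ?_ ?_
  · intro i j hij
    rcases sq_eq_sq_iff_eq_or_eq_neg.1 hij with h | h
    · have h' : ((i : ℕ) : ZMod (2 * n + 1)) = ((j : ℕ) : ZMod (2 * n + 1)) := add_right_cancel h
      rw [ZMod.natCast_eq_natCast_iff'] at h'
      rw [Nat.mod_eq_of_lt (by omega), Nat.mod_eq_of_lt (by omega)] at h'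
      exact Fin.ext h'
    · refine absurd ?_ (hcast (i + j + 2) (by omega) (by omega))
      push_cast
      linear_combination h
  · intro i
    have h := ZMod.pow_card_sub_one_eq_one (hcast (i + 1) (by omega) (by omega))
    rw [← pow_mul]
    simpa using h
  · intro s hs
    rcases lt_or_ge m s with hms | hsm
    · rw [Nat.choose_eq_zero_of_lt (show m + n < s + n by omega), add_zero]
      exact cast_choose_ne_zero (by omega) (by omega)
    · rw [← Nat.choose_symm (show s + n ≤ m + n by omega),
        show m + n - (s + n) = m - s by omega]
      rcases le_total (2 * s) m with h | h
      · exact cast_choose_add_choose_ne_zero hmn h (hF s h)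
      · have h' : 2 * (m - s) ≤ m := by omega
        have := cast_choose_add_choose_ne_zero hmn h' (hF _ h')
        rwa [show m - (m - s) = s by omega, add_comm ((m + n).choose _)] at this
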